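/- Let G be a concurrent stochastic game with countable state set S, a sink target state ⊤, and with B(s) finite for every s ∈ S. Then the value of the reachability objective equals the limit of the horizon-restricted values: for every s ∈ S, val(Reach(⊤), s) = v_∞(s) = lim_{n→∞} v_n(s). -/

import Mathlib

open scoped ENNReal Classical

/-- One step of a play: a state together with the actions chosen by Max and Min there. -/
structure Step (S A B : Type) where
  st : S
  ac : A
  bc : B

instance {S A B : Type} : MeasurableSpace (Step S A B) := ⊤

/-- A history: the list of past steps together with the current (final) state. -/
abbrev Hist (S A B : Type) := List (Step S A B) × S

/-- An infinite play. -/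
abbrev Play (S A B : Type) := ℕ → Step S A B

/-- A concurrent stochastic game: action sets for Max and Min at each state
(nonempty; countability is imposed via `Countable` instances on `S`, `A`, `B`),
and a transition probability distribution for each state and pair of actions. -/
structure Game (S A B : Type) where
  actA : S → Set A
  actB : S → Set B
  actA_nonempty : ∀ s, (actA s).Nonempty
  actB_nonempty : ∀ s, (actB s).Nonempty
  p : S → A → B → PMF S

namespace Game

variable {S A B : Type}

/-- A Max strategy assigns to each history a mixed action on the Max actions
available at the final state of the history. -/
def IsMaxStrategy (G : Game S A B) (σ : Hist S A B → PMF A) : Prop :=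
  ∀ h : Hist S A B, (σ h).support ⊆ G.actA h.2

/-- A Min strategy assigns to each history a mixed action on the Min actions
available at the final state of the history. -/
def IsMinStrategy (G : Game S A B) (π : Hist S A B → PMF B) : Prop :=
  ∀ h : Hist S A B, (π h).support ⊆ G.actB h.2

/-- A sink state: all transitions from it return to it with probability 1. -/
def IsSink (G : Game S A B) (s : S) : Prop := ∀ a b, G.p s a b s = 1

/-- A history is valid if all actions taken in it were available. -/
def ValidHist (G : Game S A B) (h : Hist S A B) : Prop :=
  ∀ z ∈ h.1, z.ac ∈ G.actA z.st ∧ z.bc ∈ G.actB z.st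

/-- Transition function extended to a mixed Max action and a pure Min action. -/
noncomputable def pA (G : Game S A B) (s : S) (α : PMF A) (b : B) : PMF S :=
  α.bind fun a => G.p s a b

/-- Transition function extended to mixed actions of both players. -/
noncomputable def pAB (G : Game S A B) (s : S) (α : PMF A) (β : PMF B) : PMF S :=
  α.bind fun a => β.bind fun b => G.p s a b

/-- The state reached after the current position: the state of the next listed
step, or the given final state if no steps remain. -/
def nextState : List (Step S A B) → S → S
  | [], t => t
  | z :: _, _ => z.st

/-- Auxiliary recursion computing the probability of a history:
`pre` is the already-consumed prefix, `cur` the current state, and the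
remaining steps and final state are processed from the left. -/
noncomputable def histProbAux (G : Game S A B)
    (σ : Hist S A B → PMF A) (π : Hist S A B → PMF B) :
    List (Step S A B) → S → List (Step S A B) → S → ℝ≥0∞
  | _, cur, [], t => if t = cur then 1 else 0
  | pre, cur, z :: rest, t =>
    if z.st = cur then
      σ (pre, cur) z.ac * π (pre, cur) z.bc *
        G.p z.st z.ac z.bc (nextState rest t) *
        histProbAux G σ π (pre ++ [z]) (nextState rest t) rest t
    else 0

/-- The probability of (the cylinder of) a history under strategies σ, π from
initial state `s0`. -/
noncomputable def histProb (G : Game S A B)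
    (σ : Hist S A B → PMF A) (π : Hist S A B → PMF B) (s0 : S) (h : Hist S A B) : ℝ≥0∞ :=
  G.histProbAux σ π [] s0 h.1 h.2

end Game

/-- The cylinder set of plays extending a given history. -/
def cylinder {S A B : Type} (h : Hist S A B) : Set (Play S A B) :=
  {ω | (∀ i : Fin h.1.length, ω i = h.1.get i) ∧ (ω h.1.length).st = h.2}

/-- A strategy is memoryless if its choice depends only on the final state. -/
def Memoryless {S A B X : Type} (σ : Hist S A B → X) : Prop :=
  ∀ h h' : Hist S A B, h.2 = h'.2 → σ h = σ h'

/-- The event that the play visits state `t`. -/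
def Reaches {S A B : Type} (t : S) : Set (Play S A B) := {ω | ∃ i, (ω i).st = t}

/-- The event that the play never visits state `t`. -/
def Avoids {S A B : Type} (t : S) : Set (Play S A B) := {ω | ∀ i, (ω i).st ≠ t}

/-- The event that the play visits state `t` within at most `n` steps. -/
def ReachesWithin {S A B : Type} (t : S) (n : ℕ) : Set (Play S A B) :=
  {ω | ∃ i ≤ n, (ω i).st = t}

/-- Expectation of `v : S → ℝ≥0∞` with respect to a distribution on `S`. -/
noncomputable def expE {S : Type} (μ : PMF S) (v : S → ℝ≥0∞) : ℝ≥0∞ := ∑' t, μ t * v t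

/-- Expectation of a real-valued `v` with respect to a distribution on `S`. -/
noncomputable def expR {S : Type} (μ : PMF S) (v : S → ℝ) : ℝ := ∑' t, (μ t).toReal * v t

/-- The mass a distribution assigns to a set of states. -/
noncomputable def massOf {S : Type} (μ : PMF S) (T : Set S) : ℝ≥0∞ :=
  ∑' t, T.indicator (⇑μ) t

namespace Game

variable {S A B : Type}

/-- `μ` is the probability measure on plays induced by strategies σ, π from
initial state `s0` (characterized on cylinder sets, by Carathéodory's
extension theorem). -/
def IsPlayMeasure (G : Game S A B) (σ : Hist S A B → PMF A) (π : Hist S A B → PMF B)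
    (s0 : S) (μ : MeasureTheory.Measure (Play S A B)) : Prop :=
  MeasureTheory.IsProbabilityMeasure μ ∧
    ∀ h : Hist S A B, μ (cylinder h) = G.histProb σ π s0 h

/-- The (lower) value `sup_σ inf_π P_{s,σ,π}(E)` of objective `E` from state `s`,
relative to the family `P` of induced play measures. -/
noncomputable def val (G : Game S A B)
    (P : (Hist S A B → PMF A) → (Hist S A B → PMF B) → S →
      MeasureTheory.Measure (Play S A B))
    (E : Set (Play S A B)) (s : S) : ℝ≥0∞ :=
  ⨆ σ ∈ {σ | G.IsMaxStrategy σ}, ⨅ π ∈ {π | G.IsMinStrategy π}, P σ π s E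

/-- The set of states from which Max has an optimal strategy for `Reaches top`. -/
def OptStates (G : Game S A B)
    (P : (Hist S A B → PMF A) → (Hist S A B → PMF B) → S →
      MeasureTheory.Measure (Play S A B))
    (top : S) : Set S :=
  {s | ∃ σ, G.IsMaxStrategy σ ∧ ∀ π, G.IsMinStrategy π →
      P σ π s (Reaches top) ≥ G.val P (Reaches top) s}

/-- A mixed Max action `α` at `s` is optimality-preserving if every Min action
gives expected value at least the value of `s`, and in case of equality the
successor distribution is supported on states admitting optimal strategies. -/
def OptPreserving (G : Game S A B)
    (P : (Hist S A B → PMF A) → (Hist S A B → PMF B) → S →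
      MeasureTheory.Measure (Play S A B))
    (top : S) (s : S) (α : PMF A) : Prop :=
  ∀ b ∈ G.actB s,
    G.val P (Reaches top) s ≤ expE (G.pA s α b) (G.val P (Reaches top)) ∧
    (expE (G.pA s α b) (G.val P (Reaches top)) = G.val P (Reaches top) s →
      (G.pA s α b).support ⊆ G.OptStates P top)

/-- A Min action `b` is value-preserving at `s` against the mixed action `α`. -/
def ValuePres (G : Game S A B)
    (P : (Hist S A B → PMF A) → (Hist S A B → PMF B) → S →
      MeasureTheory.Measure (Play S A B))
    (top : S) (s : S) (α : PMF A) (b : B) : Prop :=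
  expE (G.pA s α b) (G.val P (Reaches top)) = G.val P (Reaches top) s

end Game

namespace Game

variable {S A B : Type}

/-- Expected value of `f` after one step from `s`, when Max plays the mixed action `α` and
Min the pure action `b`. -/
noncomputable def stepExp (G : Game S A B) (f : S → ℝ≥0∞) (s : S) (α : PMF A) (b : B) : ℝ≥0∞ :=
  ∑' a, α a * ∑' t, G.p s a b t * f t

/-- The one-step lower value operator. -/
noncomputable def shapley (G : Game S A B) (f : S → ℝ≥0∞) (s : S) : ℝ≥0∞ :=
  ⨆ α : {α : PMF A // α.support ⊆ G.actA s}, ⨅ b ∈ G.actB s, G.stepExp f s α b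

/-- Value iteration for reaching `top`. -/
noncomputable def valueIter (G : Game S A B) (top : S) : ℕ → S → ℝ≥0∞
  | 0, s => if s = top then 1 else 0
  | n + 1, s => if s = top then 1 else G.shapley (valueIter G top n) s

/-- The probability that, continuing from a history with past `pre` and current state `cur`,
the play visits `top` within `n` further steps. -/
noncomputable def reachProb (G : Game S A B) (top : S) (σ : Hist S A B → PMF A)
    (π : Hist S A B → PMF B) : ℕ → List (Step S A B) → S → ℝ≥0∞
  | 0, _, cur => if cur = top then 1 else 0
  | n + 1, pre, cur => if cur = top then 1 else
      ∑' x : A × B × S, σ (pre, cur) x.1 * π (pre, cur) x.2.1 * G.p cur x.1 x.2.1 x.2.2 *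
        reachProb G top σ π n (pre ++ [⟨cur, x.1, x.2.1⟩]) x.2.2

theorem stepExp_mono (G : Game S A B) {f g : S → ℝ≥0∞} (h : f ≤ g) (s : S) (α : PMF A) (b : B) :
    G.stepExp f s α b ≤ G.stepExp g s α b := by
  unfold stepExp
  gcongr with a t
  exact h t

theorem stepExp_one (G : Game S A B) (s : S) (α : PMF A) (b : B) :
    G.stepExp (fun _ => 1) s α b = 1 := by
  simp [stepExp, PMF.tsum_coe]

theorem shapley_mono (G : Game S A B) {f g : S → ℝ≥0∞} (h : f ≤ g) (s : S) :
    G.shapley f s ≤ G.shapley g s :=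
  iSup_mono fun _ => iInf₂_mono fun _ _ => G.stepExp_mono h _ _ _

theorem shapley_le_one (G : Game S A B) {f : S → ℝ≥0∞} (h : ∀ t, f t ≤ 1) (s : S) :
    G.shapley f s ≤ 1 := by
  obtain ⟨b, hb⟩ := G.actB_nonempty s
  refine iSup_le fun α => (iInf₂_le b hb).trans ?_
  exact (G.stepExp_mono h s α b).trans (G.stepExp_one s α b).le

theorem valueIter_le_one (G : Game S A B) (top : S) (n : ℕ) (s : S) :
    G.valueIter top n s ≤ 1 := by
  induction n generalizing s with
  | zero => unfold valueIter; split_ifs <;> simp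
  | succ n ih =>
    unfold valueIter
    split_ifs
    · exact le_rfl
    · exact G.shapley_le_one ih s

theorem valueIter_top (G : Game S A B) (top : S) (n : ℕ) : G.valueIter top n top = 1 := by
  cases n <;> simp [valueIter]

theorem monotone_valueIter (G : Game S A B) (top : S) : Monotone (G.valueIter top) := by
  refine monotone_nat_of_le_succ fun n => ?_
  induction n with
  | zero => intro s; simp only [valueIter]; split_ifs <;> simp
  | succ n ih =>
    intro s
    rw [valueIter, valueIter]
    split_ifs
    · exact le_rfl
    · exact G.shapley_mono ih s

theorem stepExp_iSup (G : Game S A B) {f : ℕ → S → ℝ≥0∞} (hf : Monotone f) (s : S) (α : PMF A)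
    (b : B) : G.stepExp (fun t => ⨆ n, f n t) s α b = ⨆ n, G.stepExp (f n) s α b := by
  have key : ∀ {X : Type} (g : ℕ → X → ℝ≥0∞), Monotone g →
      ∑' x, ⨆ n, g n x = ⨆ n, ∑' x, g n x := by
    intro X g hg
    let _ : MeasurableSpace X := ⊤
    simp_rw [← MeasureTheory.lintegral_count]
    exact MeasureTheory.lintegral_iSup (fun n => measurable_from_top) hg
  unfold stepExp
  simp_rw [ENNReal.mul_iSup]
  rw [← key]
  · refine tsum_congr fun a => ?_
    rw [key, ENNReal.mul_iSup]
    intro m n hmn t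
    dsimp only
    gcongr
    exact hf hmn t
  · intro m n hmn a
    dsimp only
    gcongr with t
    exact hf hmn t

/-- If Min has finitely many actions, some action keeps the limit of value iteration from
increasing in expectation. -/
theorem exists_stepExp_le (G : Game S A B) (top : S) {s : S} (hs : s ≠ top)
    (hB : (G.actB s).Finite) {α : PMF A} (hα : α.support ⊆ G.actA s) :
    ∃ b ∈ G.actB s, G.stepExp (fun t => ⨆ n, G.valueIter top n t) s α b
      ≤ ⨆ n, G.valueIter top n s := by
  by_contra! hcon
  have hn : ∀ b ∈ G.actB s, ∃ n, (⨆ n, G.valueIter top n s) <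
      G.stepExp (G.valueIter top n) s α b := by
    intro b hb
    have := hcon b hb
    rw [G.stepExp_iSup (G.monotone_valueIter top)] at this
    exact lt_iSup_iff.1 this
  choose! n hn using hn
  obtain ⟨N, hN⟩ := (hB.image n).bddAbove
  obtain ⟨b, hb, hmin⟩ := hB.exists_minimalFor
    (fun b => G.stepExp (G.valueIter top N) s α b) _ (G.actB_nonempty s)
  have hlt : (⨆ n, G.valueIter top n s) < G.stepExp (G.valueIter top N) s α b :=
    (hn b hb).trans_le <| G.stepExp_mono
      (G.monotone_valueIter top (hN (Set.mem_image_of_mem n hb))) _ _ _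
  refine absurd hlt (not_lt.2 ?_)
  calc G.stepExp (G.valueIter top N) s α b
      ≤ ⨅ b ∈ G.actB s, G.stepExp (G.valueIter top N) s α b := by
        refine le_iInf₂ fun c hc => ?_
        rcases le_total (G.stepExp (G.valueIter top N) s α b)
          (G.stepExp (G.valueIter top N) s α c) with h | h
        · exact h
        · exact hmin hc h
    _ ≤ G.shapley (G.valueIter top N) s :=
        le_iSup (fun α : {α : PMF A // α.support ⊆ G.actA s} =>
          ⨅ b ∈ G.actB s, G.stepExp (G.valueIter top N) s α b) ⟨α, hα⟩
    _ = G.valueIter top (N + 1) s := by simp [valueIter, hs]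
    _ ≤ _ := le_iSup (fun n => G.valueIter top n s) (N + 1)

theorem tsum_step_eq (G : Game S A B) (f : S → ℝ≥0∞) (s : S) (α : PMF A) (β : PMF B) :
    ∑' x : A × B × S, α x.1 * β x.2.1 * G.p s x.1 x.2.1 x.2.2 * f x.2.2
      = ∑' b, β b * G.stepExp f s α b := by
  rw [ENNReal.tsum_prod']
  simp_rw [ENNReal.tsum_prod' (α := B) (β := S)]
  rw [ENNReal.tsum_comm]
  refine tsum_congr fun b => ?_
  rw [stepExp, ← ENNReal.tsum_mul_left]
  refine tsum_congr fun a => ?_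
  simp_rw [← ENNReal.tsum_mul_left]
  refine tsum_congr fun t => ?_
  ring

theorem tsum_step_one (G : Game S A B) (s : S) (α : PMF A) (β : PMF B) :
    ∑' x : A × B × S, α x.1 * β x.2.1 * G.p s x.1 x.2.1 x.2.2 = 1 := by
  have := G.tsum_step_eq (fun _ => 1) s α β
  simpa [stepExp_one, PMF.tsum_coe] using this

theorem reachProb_le (G : Game S A B) (top : S) {σ : Hist S A B → PMF A}
    {π : Hist S A B → PMF B} {w : S → ℝ≥0∞} (hw : w top = 1)
    (hstep : ∀ h : Hist S A B, h.2 ≠ top →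
      ∑' b, π h b * G.stepExp w h.2 (σ h) b ≤ w h.2)
    (n : ℕ) (pre : List (Step S A B)) (cur : S) : G.reachProb top σ π n pre cur ≤ w cur := by
  induction n generalizing pre cur with
  | zero =>
    unfold reachProb
    split_ifs with h
    · rw [h, hw]
    · exact zero_le
  | succ n ih =>
    unfold reachProb
    split_ifs with h
    · rw [h, hw]
    · refine le_trans ?_ (hstep (pre, cur) h)
      rw [← tsum_step_eq]
      gcongr
      exact ih _ _

theorem valueIter_le_reachProb (G : Game S A B) (top : S) {ε : ℝ≥0∞} {N : ℕ}
    {α : ℕ → S → PMF A} {π : Hist S A B → PMF B} (hπ : G.IsMinStrategy π)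
    (hα : ∀ m s, ∀ b ∈ G.actB s,
      G.shapley (G.valueIter top m) s ≤ G.stepExp (G.valueIter top m) s (α m s) b + ε)
    (n : ℕ) (pre : List (Step S A B)) (cur : S) (hn : pre.length + n = N) :
    G.valueIter top n cur ≤
      G.reachProb top (fun h => α (N - h.1.length - 1) h.2) π n pre cur + n * ε := by
  induction n generalizing pre cur with
  | zero => simp [valueIter, reachProb]
  | succ n ih =>
    unfold valueIter reachProb
    split_ifs with h
    · exact le_self_add
    have hm : N - pre.length - 1 = n := by omega
    simp only [hm]
    set β := π (pre, cur)
    set c : A × B × S → ℝ≥0∞ :=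
      fun x => α n cur x.1 * β x.2.1 * G.p cur x.1 x.2.1 x.2.2 with hc
    have hc1 : ∑' x, c x = 1 := G.tsum_step_one cur (α n cur) β
    calc G.shapley (G.valueIter top n) cur
        = ∑' b, β b * G.shapley (G.valueIter top n) cur := by
          rw [ENNReal.tsum_mul_right, PMF.tsum_coe, one_mul]
      _ ≤ ∑' b, β b * (G.stepExp (G.valueIter top n) cur (α n cur) b + ε) := by
          refine ENNReal.tsum_le_tsum fun b => ?_
          by_cases hb : b ∈ β.support
          · gcongr
            exact hα n cur b (hπ (pre, cur) hb)
          · rw [(PMF.apply_eq_zero_iff _ _).2 hb]; simp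
      _ = (∑' x : A × B × S, c x * G.valueIter top n x.2.2) + ε := by
          simp_rw [mul_add]
          rw [ENNReal.tsum_add, ENNReal.tsum_mul_right, PMF.tsum_coe, one_mul, hc, tsum_step_eq]
      _ ≤ (∑' x : A × B × S, c x * (G.reachProb top (fun h => α (N - h.1.length - 1) h.2) π n
            (pre ++ [⟨cur, x.1, x.2.1⟩]) x.2.2 + n * ε)) + ε := by
          gcongr with x
          exact ih _ _ (by simp; omega)
      _ = _ := by
          simp_rw [mul_add]
          rw [ENNReal.tsum_add, ENNReal.tsum_mul_right, hc1]
          push_cast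
          ring

theorem exists_shapley_le_add (G : Game S A B) {f : S → ℝ≥0∞} (hf : ∀ t, f t ≤ 1) {ε : ℝ≥0∞}
    (hε : ε ≠ 0) (s : S) : ∃ α : PMF A, α.support ⊆ G.actA s ∧
      ∀ b ∈ G.actB s, G.shapley f s ≤ G.stepExp f s α b + ε := by
  obtain ⟨a, ha⟩ := G.actA_nonempty s
  have : Nonempty {α : PMF A // α.support ⊆ G.actA s} := ⟨PMF.pure a, by simpa using ha⟩
  have hfin : G.shapley f s ≠ ⊤ := ((G.shapley_le_one hf s).trans_lt ENNReal.one_lt_top).ne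
  by_contra! hcon
  have : G.shapley f s + ε ≤ G.shapley f s := by
    conv_lhs => rw [shapley]
    rw [ENNReal.iSup_add]
    refine iSup_le fun α => ?_
    obtain ⟨b, hb, hlt⟩ := hcon α.1 α.2
    exact (add_le_add_left (iInf₂_le b hb) ε).trans hlt.le
  exact absurd this (not_le.2 (ENNReal.lt_add_right hfin hε))

theorem histProbAux_append (G : Game S A B) (σ : Hist S A B → PMF A) (π : Hist S A B → PMF B)
    (l pre : List (Step S A B)) (cur s : S) (a : A) (b : B) (t : S) :
    G.histProbAux σ π pre cur (l ++ [⟨s, a, b⟩]) t =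
      G.histProbAux σ π pre cur l s *
        (σ (pre ++ l, s) a * π (pre ++ l, s) b * G.p s a b t) := by
  induction l generalizing pre cur with
  | nil =>
    by_cases h : s = cur
    · simp [histProbAux, nextState, h]
    · simp [histProbAux, h]
  | cons z l ih =>
    have hnext : nextState (l ++ [⟨s, a, b⟩]) t = nextState l s := by
      cases l <;> rfl
    rw [List.cons_append, histProbAux, histProbAux, hnext]
    split_ifs with h
    · rw [ih, List.append_assoc, List.singleton_append]
      ring
    · simp

theorem mem_cylinder_append {l : List (Step S A B)} {z : Step S A B} {t : S}
    {ω : Play S A B} : ω ∈ cylinder (l ++ [z], t) ↔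
      (∀ i : Fin l.length, ω i = l.get i) ∧ ω l.length = z ∧ (ω (l.length + 1)).st = t := by
  simp only [cylinder, Set.mem_ofPred_eq, List.length_append, List.length_singleton, ← and_assoc]
  refine and_congr_left fun _ => ?_
  constructor
  · intro h
    refine ⟨fun i => ?_, ?_⟩
    · simpa using h ⟨i, by simp⟩
    · simpa using h ⟨l.length, by simp⟩
  · rintro ⟨h1, h2⟩ ⟨i, hi⟩
    have hi' : i < l.length + 1 := by simpa using hi
    rcases Nat.lt_succ_iff_lt_or_eq.1 hi' with hlt | rfl
    · simpa [List.getElem_append_left hlt] using h1 ⟨i, hlt⟩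
    · simpa using h2

theorem measurableSet_st_eq (i : ℕ) (t : S) : MeasurableSet {ω : Play S A B | (ω i).st = t} :=
  measurableSet_preimage (t := {z : Step S A B | z.st = t}) (measurable_pi_apply i) trivial

theorem measurableSet_cylinder (h : Hist S A B) : MeasurableSet (cylinder h) := by
  have : cylinder h = (⋂ i : Fin h.1.length, (fun ω : Play S A B => ω i) ⁻¹' {h.1.get i}) ∩
      {ω | (ω h.1.length).st = h.2} := by
    ext ω; simp [cylinder]
  rw [this]
  exact (MeasurableSet.iInter fun i =>
    measurableSet_preimage (t := {h.1.get i}) (measurable_pi_apply (i : ℕ)) trivial).inter (measurableSet_st_eq _ _)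

theorem measurableSet_reach_shift (top : S) (k n : ℕ) :
    MeasurableSet {ω : Play S A B | ∃ i ≤ n, (ω (k + i)).st = top} := by
  have : {ω : Play S A B | ∃ i ≤ n, (ω (k + i)).st = top} =
      ⋃ i, ⋃ _ : i ≤ n, {ω | (ω (k + i)).st = top} := by
    ext; simp
  rw [this]
  exact MeasurableSet.iUnion fun i => MeasurableSet.iUnion fun _ => measurableSet_st_eq _ _

theorem IsPlayMeasure.measure_cylinder_inter [Countable S] [Countable A] [Countable B]
    {G : Game S A B} {σ : Hist S A B → PMF A} {π : Hist S A B → PMF B} {s0 : S}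
    {μ : MeasureTheory.Measure (Play S A B)} (hμ : G.IsPlayMeasure σ π s0 μ) (top : S)
    (n : ℕ) (pre : List (Step S A B)) (cur : S) :
    μ (cylinder (pre, cur) ∩ {ω | ∃ i ≤ n, (ω (pre.length + i)).st = top}) =
      G.histProb σ π s0 (pre, cur) * G.reachProb top σ π n pre cur := by
  have htop : ∀ n (pre : List (Step S A B)) (cur : S), cur = top →
      cylinder (pre, cur) ∩ {ω | ∃ i ≤ n, (ω (pre.length + i)).st = top} =
        cylinder (pre, cur) := fun n pre cur h =>
    Set.inter_eq_left.2 fun ω hω => by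
      exact ⟨0, Nat.zero_le n, hω.2.trans h⟩
  induction n generalizing pre cur with
  | zero =>
    by_cases h : cur = top
    · rw [htop 0 _ _ h, hμ.2, reachProb, if_pos h, mul_one]
    · rw [reachProb, if_neg h, mul_zero]
      convert MeasureTheory.measure_empty (μ := μ)
      ext ω
      simp only [Set.mem_inter_iff, Set.mem_ofPred_eq, Set.mem_empty_iff_false, iff_false, not_and]
      rintro hω ⟨i, hi, hi'⟩
      obtain rfl : i = 0 := by omega
      exact h (hω.2.symm.trans hi')
  | succ n ih =>
    by_cases h : cur = top
    · rw [htop _ _ _ h, hμ.2, reachProb, if_pos h, mul_one]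
    have hE : cylinder (pre, cur) ∩ {ω | ∃ i ≤ n + 1, (ω (pre.length + i)).st = top} =
        ⋃ x : A × B × S, cylinder (pre ++ [(⟨cur, x.1, x.2.1⟩ : Step S A B)], x.2.2) ∩
          {ω | ∃ i ≤ n, (ω ((pre ++ [(⟨cur, x.1, x.2.1⟩ : Step S A B)]).length + i)).st = top} := by
      ext ω
      simp only [Set.mem_iUnion, Set.mem_inter_iff, mem_cylinder_append, Set.mem_ofPred_eq,
        List.length_append, List.length_singleton]
      constructor
      · rintro ⟨hω, i, hi, hi'⟩
        refine ⟨((ω pre.length).ac, (ω pre.length).bc, (ω (pre.length + 1)).st),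
          ⟨hω.1, ?_, rfl⟩, ?_⟩
        · rw [← (show (ω pre.length).st = cur from hω.2)]
        · cases i with
          | zero => exact absurd (hω.2.symm.trans hi') h
          | succ i => exact ⟨i, by omega, by rwa [add_assoc, add_comm 1]⟩
      · rintro ⟨x, ⟨h1, h2, -⟩, i, hi, hi'⟩
        exact ⟨⟨h1, by simp [h2]⟩, i + 1, by omega, by rwa [add_assoc, add_comm 1] at hi'⟩
    rw [hE, MeasureTheory.measure_iUnion]
    · rw [reachProb, if_neg h, ← ENNReal.tsum_mul_left]
      refine tsum_congr fun x => ?_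
      rw [ih]
      simp only [histProb, histProbAux_append, List.nil_append]
      ring
    · intro x y hxy
      refine Set.disjoint_left.2 fun ω hx hy => hxy ?_
      have hx' := mem_cylinder_append.1 hx.1
      have hy' := mem_cylinder_append.1 hy.1
      have hz := hx'.2.1.symm.trans hy'.2.1
      simp only [Step.mk.injEq, true_and] at hz
      exact Prod.ext hz.1 (Prod.ext hz.2 (hx'.2.2.symm.trans hy'.2.2))
    · exact fun x => (measurableSet_cylinder _).inter (measurableSet_reach_shift _ _ _)

theorem IsPlayMeasure.measure_reachesWithin [Countable S] [Countable A] [Countable B]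
    {G : Game S A B} {σ : Hist S A B → PMF A} {π : Hist S A B → PMF B} {s0 : S}
    {μ : MeasureTheory.Measure (Play S A B)} (hμ : G.IsPlayMeasure σ π s0 μ) (top : S) (n : ℕ) :
    μ (ReachesWithin top n) = G.reachProb top σ π n [] s0 := by
  have := hμ.1
  have h1 : G.histProb σ π s0 ([], s0) = 1 := by simp [histProb, histProbAux]
  have hcyl : μ (cylinder ([], s0)) = 1 := (hμ.2 _).trans h1
  have hae : ∀ᵐ ω ∂μ, ω ∈ cylinder (([] : List (Step S A B)), s0) :=
    (MeasureTheory.prob_compl_eq_zero_iff (measurableSet_cylinder _)).2 hcyl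
  have := hμ.measure_cylinder_inter top n [] s0
  rw [h1, one_mul] at this
  rw [← this]
  refine MeasureTheory.measure_congr ?_
  filter_upwards [hae] with ω hω
  refine propext ⟨fun ⟨i, hi, h⟩ => ⟨hω, i, hi, ?_⟩, fun ⟨_, i, hi, h⟩ => ⟨i, hi, ?_⟩⟩
  · simpa using h
  · simpa using h

theorem monotone_reachesWithin (top : S) :
    Monotone (ReachesWithin top : ℕ → Set (Play S A B)) :=
  fun _ _ hmn _ ⟨i, hi, h⟩ => ⟨i, hi.trans hmn, h⟩

theorem reaches_eq_iUnion (top : S) :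
    (Reaches top : Set (Play S A B)) = ⋃ n, ReachesWithin top n := by
  ext ω
  simp only [Reaches, ReachesWithin, Set.mem_iUnion, Set.mem_ofPred_eq]
  exact ⟨fun ⟨i, h⟩ => ⟨i, i, le_rfl, h⟩, fun ⟨_, i, _, h⟩ => ⟨i, h⟩⟩

theorem val_mono (G : Game S A B)
    (P : (Hist S A B → PMF A) → (Hist S A B → PMF B) → S → MeasureTheory.Measure (Play S A B))
    {E F : Set (Play S A B)} (h : E ⊆ F) (s : S) : G.val P E s ≤ G.val P F s :=
  iSup₂_mono fun _ _ => iInf₂_mono fun _ _ => MeasureTheory.measure_mono h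

theorem valueIter_le_val [Countable S] [Countable A] [Countable B] (G : Game S A B) (top : S)
    {P : (Hist S A B → PMF A) → (Hist S A B → PMF B) → S → MeasureTheory.Measure (Play S A B)}
    (hP : ∀ σ π s, G.IsMaxStrategy σ → G.IsMinStrategy π → G.IsPlayMeasure σ π s (P σ π s))
    (n : ℕ) (s : S) :
    G.valueIter top n s ≤ G.val P (ReachesWithin top n) s := by
  refine ENNReal.le_of_forall_pos_le_add fun δ hδ _ => ?_
  have hε : (δ : ℝ≥0∞) / n ≠ 0 :=
    ENNReal.div_ne_zero.2 ⟨by simpa using hδ.ne', ENNReal.natCast_ne_top n⟩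
  choose α hα hα' using fun m t =>
    G.exists_shapley_le_add (G.valueIter_le_one top m) hε t
  have hσ : G.IsMaxStrategy fun h => α (n - h.1.length - 1) h.2 := fun h => hα _ _
  refine le_trans ?_ (add_le_add_left (le_iSup₂_of_le _ hσ le_rfl) _)
  rw [← tsub_le_iff_right]
  refine le_iInf₂ fun π hπ => ?_
  rw [tsub_le_iff_right, (hP _ π s hσ hπ).measure_reachesWithin]
  refine (G.valueIter_le_reachProb top hπ hα' n [] s (Nat.zero_add n)).trans ?_
  gcongr
  exact ENNReal.mul_div_le

theorem val_reaches_le [Countable S] [Countable A] [Countable B] (G : Game S A B) (top : S)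
    {P : (Hist S A B → PMF A) → (Hist S A B → PMF B) → S → MeasureTheory.Measure (Play S A B)}
    (hP : ∀ σ π s, G.IsMaxStrategy σ → G.IsMinStrategy π → G.IsPlayMeasure σ π s (P σ π s))
    (hB : ∀ s, (G.actB s).Finite) (s : S) :
    G.val P (Reaches top) s ≤ ⨆ n, G.valueIter top n s := by
  refine iSup₂_le fun σ hσ => ?_
  have hex : ∀ h : Hist S A B, ∃ b ∈ G.actB h.2, h.2 ≠ top →
      G.stepExp (fun t => ⨆ n, G.valueIter top n t) h.2 (σ h) b
        ≤ ⨆ n, G.valueIter top n h.2 := by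
    intro h
    by_cases ht : h.2 = top
    · obtain ⟨b, hb⟩ := G.actB_nonempty h.2
      exact ⟨b, hb, fun hne => absurd ht hne⟩
    · obtain ⟨b, hb, hle⟩ := G.exists_stepExp_le top ht (hB h.2) (hσ h)
      exact ⟨b, hb, fun _ => hle⟩
  choose b hb hle using hex
  have hπ : G.IsMinStrategy fun h => PMF.pure (b h) := fun h => by simpa using hb h
  refine (iInf₂_le _ hπ).trans ?_
  rw [reaches_eq_iUnion, (monotone_reachesWithin top).measure_iUnion]
  refine iSup_le fun n => ?_
  rw [(hP σ _ s hσ hπ).measure_reachesWithin]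
  refine G.reachProb_le top (w := fun t => ⨆ n, G.valueIter top n t) ?_ ?_ n [] s
  · simp [valueIter_top]
  · intro h ht
    refine le_trans (le_of_eq ?_) (hle h ht)
    rw [tsum_eq_single (b h)]
    · simp
    · intro c hc
      simp [hc]

end Game

/-- Lemma 3: the value of the reachability objective equals the
limit of the horizon-restricted values. -/
theorem stmt11 {S A B : Type} [Countable S] [Countable A] [Countable B]
    (G : Game S A B) (top : S) (htop : G.IsSink top)
    (hB : ∀ s, (G.actB s).Finite)
    (P : (Hist S A B → PMF A) → (Hist S A B → PMF B) → S →
      MeasureTheory.Measure (Play S A B))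
    (hP : ∀ σ π s, G.IsMaxStrategy σ → G.IsMinStrategy π →
      G.IsPlayMeasure σ π s (P σ π s))
    (vinf : S → ℝ≥0∞)
    (hvinf : ∀ s : S, Filter.Tendsto (fun n => G.val P (ReachesWithin top n) s)
      Filter.atTop (nhds (vinf s))) :
    ∀ s : S, G.val P (Reaches top) s = vinf s := by
  intro s
  refine le_antisymm ?_ ?_
  · refine (G.val_reaches_le top hP hB s).trans (iSup_le fun n => ?_)
    refine (G.valueIter_le_val top hP n s).trans ?_
    refine Monotone.ge_of_tendsto (fun m n hmn => ?_) (hvinf s) n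
    exact G.val_mono P (Game.monotone_reachesWithin top hmn) s
  · refine le_of_tendsto' (hvinf s) fun n => G.val_mono P ?_ s
    rw [Game.reaches_eq_iUnion]
    exact Set.subset_iUnion _ n
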